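/- arXiv:1903.07794 — 2 statements merged into one kernel-verified Lean document; each statement's English description precedes it below -/
import Mathlib

section
/- (Negative semi-definiteness of the second-order derivative of the first Dirichlet eigenvalue; Theorem C.) Let ℓ > 0 and let q, g : ℝ → ℝ be continuous on [0,ℓ]. Let λ := λ₁^D(q) be defined by the Rayleigh-quotient infimum. Suppose U : ℝ → ℝ is twice continuously differentiable on [0,ℓ] with −U″(x) + (q(x) − λ)·U(x) = −g(x) for all x ∈ [0,ℓ], and satisfies U(0) = 0, U′(0) = 0 and U(ℓ) = 0. Then 2·∫₀^ℓ g(x)·U(x) dx ≤ 0. -/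
open Set intervalIntegral

/-- The first Dirichlet eigenvalue of `-z'' + q z = λ z` on `[0, ℓ]`,
defined via its variational (Rayleigh quotient) characterization. -/
noncomputable def lambda1D (ℓ : ℝ) (q : ℝ → ℝ) : ℝ :=
  sInf {r : ℝ | ∃ z : ℝ → ℝ, ContDiffOn ℝ 1 z (Set.Icc 0 ℓ) ∧ z 0 = 0 ∧ z ℓ = 0 ∧
    (∫ x in (0:ℝ)..ℓ, (z x) ^ 2) = 1 ∧
    r = ∫ x in (0:ℝ)..ℓ, ((deriv z x) ^ 2 + q x * (z x) ^ 2)}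

theorem deriv_eqOn_derivWithin_Icc (z : ℝ → ℝ) (a b : ℝ) :
    EqOn (deriv z) (derivWithin z (Icc a b)) (Ioo a b) := fun _ hx ↦
  (derivWithin_of_mem_nhds (Icc_mem_nhds hx.1 hx.2)).symm

theorem integral_deriv_sq_add_eq_derivWithin {a b : ℝ} (hab : a ≤ b) (q z : ℝ → ℝ) :
    ∫ x in a..b, ((deriv z x) ^ 2 + q x * (z x) ^ 2) =
      ∫ x in a..b, ((derivWithin z (Icc a b) x) ^ 2 + q x * (z x) ^ 2) :=
  integral_congr_Ioo_of_le hab fun x hx ↦ by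
    simp only [deriv_eqOn_derivWithin_Icc z a b hx]

theorem mul_integral_sq_le_rayleigh {ℓ m : ℝ} (hℓ : 0 < ℓ) {q z : ℝ → ℝ}
    (hq : ContinuousOn q (Icc 0 ℓ)) (hm : ∀ x ∈ Icc 0 ℓ, m ≤ q x)
    (hz : ContDiffOn ℝ 1 z (Icc 0 ℓ)) :
    m * (∫ x in (0:ℝ)..ℓ, (z x) ^ 2) ≤
      ∫ x in (0:ℝ)..ℓ, ((deriv z x) ^ 2 + q x * (z x) ^ 2) := by
  have hd : ContinuousOn (derivWithin z (Icc 0 ℓ)) (Icc 0 ℓ) :=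
    hz.continuousOn_derivWithin (uniqueDiffOn_Icc hℓ) le_rfl
  have hzc := hz.continuousOn
  rw [← integral_const_mul, integral_deriv_sq_add_eq_derivWithin hℓ.le]
  refine integral_mono_on hℓ.le
    (ContinuousOn.intervalIntegrable_of_Icc hℓ.le (by fun_prop))
    (ContinuousOn.intervalIntegrable_of_Icc hℓ.le (by fun_prop)) fun x hx ↦ ?_
  nlinarith [hm x hx, sq_nonneg (z x), sq_nonneg (derivWithin z (Icc 0 ℓ) x)]

theorem lambda1D_mul_integral_sq_le {ℓ : ℝ} (hℓ : 0 < ℓ) {q z : ℝ → ℝ}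
    (hq : ContinuousOn q (Icc 0 ℓ)) (hz : ContDiffOn ℝ 1 z (Icc 0 ℓ))
    (hz0 : z 0 = 0) (hzl : z ℓ = 0) :
    lambda1D ℓ q * (∫ x in (0:ℝ)..ℓ, (z x) ^ 2) ≤
      ∫ x in (0:ℝ)..ℓ, ((deriv z x) ^ 2 + q x * (z x) ^ 2) := by
  obtain ⟨m, hm⟩ := (isCompact_Icc (a := (0:ℝ)) (b := ℓ)).bddBelow_image hq
  replace hm : ∀ x ∈ Icc 0 ℓ, m ≤ q x := fun x hx ↦ hm (mem_image_of_mem q hx)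
  have hnonneg : 0 ≤ ∫ x in (0:ℝ)..ℓ, (z x) ^ 2 :=
    integral_nonneg hℓ.le fun x _ ↦ sq_nonneg _
  rcases hnonneg.eq_or_lt with hc | hc
  · have h := mul_integral_sq_le_rayleigh hℓ hq hm hz
    rw [← hc, mul_zero] at h ⊢
    exact h
  · set c := ∫ x in (0:ℝ)..ℓ, (z x) ^ 2
    set s := (√c)⁻¹
    have hs : s ^ 2 = c⁻¹ := by rw [inv_pow, Real.sq_sqrt hc.le]
    rw [← le_div_iff₀ hc]
    refine csInf_le ⟨m, ?_⟩ ⟨fun x ↦ s * z x, contDiffOn_const.mul hz, by simp [hz0],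
      by simp [hzl], ?_, ?_⟩
    · rintro r ⟨w, hw, -, -, hw1, rfl⟩
      simpa [hw1] using mul_integral_sq_le_rayleigh hℓ hq hm hw
    · simp only [mul_pow, integral_const_mul, hs]
      exact inv_mul_cancel₀ hc.ne'
    · rw [div_eq_inv_mul, ← hs, ← integral_const_mul]
      congr 1 with x
      rw [deriv_const_mul_field]
      ring

/-- Integration by parts with vanishing boundary values. -/
theorem integral_deriv_sq_add_mul_deriv_deriv_eq_zero {a b : ℝ} (hab : a < b) {u : ℝ → ℝ}
    (hu : ContDiffOn ℝ 2 u (Icc a b)) (hua : u a = 0) (hub : u b = 0) :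
    ∫ x in a..b, ((deriv u x) ^ 2 + u x * deriv (deriv u) x) = 0 := by
  set v := derivWithin u (Icc a b)
  set w := derivWithin v (Icc a b)
  have hv : ContDiffOn ℝ 1 v (Icc a b) := hu.derivWithin (uniqueDiffOn_Icc hab) (by norm_num)
  have hw : ContinuousOn w (Icc a b) :=
    hv.continuousOn_derivWithin (uniqueDiffOn_Icc hab) le_rfl
  have huc := hu.continuousOn
  have hvc := hv.continuousOn
  have huv : EqOn (deriv u) v (Ioo a b) := deriv_eqOn_derivWithin_Icc u a b
  have hvw : EqOn (deriv v) w (Ioo a b) := deriv_eqOn_derivWithin_Icc v a b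
  have hdd : EqOn (deriv (deriv u)) w (Ioo a b) := fun x hx ↦
    (huv.eventuallyEq_of_mem (Ioo_mem_nhds hx.1 hx.2)).deriv_eq.trans (hvw hx)
  rw [integral_congr_Ioo_of_le hab.le (g := fun x ↦ v x * v x + u x * w x)
    fun x hx ↦ by simp only [huv hx, hdd hx, sq]]
  rw [integral_eq_sub_of_hasDerivAt_of_le (f := fun x ↦ u x * v x) hab.le (by fun_prop) ?_
    (ContinuousOn.intervalIntegrable_of_Icc hab.le (by fun_prop))]
  · simp [hua, hub]
  · intro x hx
    have hn := Icc_mem_nhds hx.1 hx.2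
    have h1 := ((hu.contDiffAt hn).differentiableAt (by norm_num)).hasDerivAt
    have h2 := ((hv.contDiffAt hn).differentiableAt (by norm_num)).hasDerivAt
    rw [huv hx] at h1
    rw [hvw hx] at h2
    exact h1.mul h2

/-- Negative semi-definiteness of the second-order derivative of the first Dirichlet
eigenvalue (Theorem C): if `-U'' + (q − λ₁^D(q)) U = −g` with `U(0) = U'(0) = 0` and
`U(ℓ) = 0`, then `2 ∫₀^ℓ g U ≤ 0`. -/
theorem second_derivative_neg_semidefinite (ℓ : ℝ) (hℓ : 0 < ℓ) (q g U : ℝ → ℝ)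
    (hq : ContinuousOn q (Set.Icc 0 ℓ)) (hg : ContinuousOn g (Set.Icc 0 ℓ))
    (hU : ContDiffOn ℝ 2 U (Set.Icc 0 ℓ))
    (hUode : ∀ x ∈ Set.Icc (0:ℝ) ℓ,
      -(deriv (deriv U) x) + (q x - lambda1D ℓ q) * U x = -g x)
    (hU0 : U 0 = 0) (hU0' : deriv U 0 = 0) (hUl : U ℓ = 0) :
    2 * ∫ x in (0:ℝ)..ℓ, g x * U x ≤ 0 := by
  have hU1 : ContDiffOn ℝ 1 U (Icc 0 ℓ) := hU.of_le (by norm_num)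
  have hUc := hU.continuousOn
  have hd : ContinuousOn (derivWithin U (Icc 0 ℓ)) (Icc 0 ℓ) :=
    hU1.continuousOn_derivWithin (uniqueDiffOn_Icc hℓ) le_rfl
  have hR := lambda1D_mul_integral_sq_le hℓ hq hU1 hU0 hUl
  have hP := integral_deriv_sq_add_mul_deriv_deriv_eq_zero hℓ hU hU0 hUl
  rw [integral_deriv_sq_add_eq_derivWithin hℓ.le] at hR
  set L := lambda1D ℓ q
  set V := derivWithin U (Icc 0 ℓ)
  have hUV : EqOn (deriv U) V (Ioo 0 ℓ) := deriv_eqOn_derivWithin_Icc U 0 ℓ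
  rw [integral_congr_Ioo_of_le hℓ.le
    (g := fun x ↦ (V x ^ 2 + q x * U x ^ 2) - L * U x ^ 2 + g x * U x) fun x hx ↦ by
      simp only [hUV hx]
      linear_combination (-U x) * hUode x (Ioo_subset_Icc_self hx)] at hP
  have hi {f : ℝ → ℝ} (hf : ContinuousOn f (Icc 0 ℓ)) :
      IntervalIntegrable f MeasureTheory.volume 0 ℓ := hf.intervalIntegrable_of_Icc hℓ.le
  rw [integral_add (hi (by fun_prop)) (hi (by fun_prop)),
    integral_sub (hi (by fun_prop)) (hi (by fun_prop)), integral_const_mul] at hP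
  linarith
end

section
/- (Equality of the two expressions for the second-order derivative; Theorem A, (D21) = (D22).) Let ℓ > 0 and let Q, E, h : ℝ → ℝ be continuous on [0,ℓ] with ∫₀^ℓ E(u)² du = 1. Set L := ∫₀^ℓ E(u)²·h(u) du. Let ψ₁, ψ₂ : ℝ → ℝ be twice continuously differentiable on [0,ℓ] with −ψᵢ″(x) + Q(x)·ψᵢ(x) = 0 on [0,ℓ] for i = 1,2, and with initial values ψ₁(0) = 1, ψ₁′(0) = 0, ψ₂(0) = 0, ψ₂′(0) = 1. Define W(x,y) := ψ₁(x)·ψ₂(y) − ψ₂(x)·ψ₁(y), U(x) := ∫₀^x W(x,y)·E(y)·(L − h(y)) dy, G(x,y) := W(x,y) if x ≤ y and −W(x,y) if y ≤ x, J₄(x,y,u,v) := G(x,y)·E(u)·E(v) − G(x,v)·E(u)·E(y) − G(u,y)·E(x)·E(v) + G(u,v)·E(x)·E(y), and J(x,y) := (∫₀^ℓ ∫₀^ℓ J₄(x,y,u,v)·E(u)·E(v) du dv) · E(x)·E(y). Then 2·∫₀^ℓ E(x)·(h(x) − L)·U(x) dx = ∫₀^ℓ ∫₀^ℓ J(x,y)·h(x)·h(y)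 dx dy. -/
open Set intervalIntegral

/-- The symmetrization of the kernel `p x * q y - q x * p y`. -/
noncomputable def symmKernel (p q : ℝ → ℝ) (x y : ℝ) : ℝ :=
  p (min x y) * q (max x y) - q (min x y) * p (max x y)

lemma symmKernel_comm (p q : ℝ → ℝ) (x y : ℝ) : symmKernel p q x y = symmKernel p q y x := by
  simp only [symmKernel, min_comm, max_comm]

lemma symmKernel_of_le (p q : ℝ → ℝ) {x y : ℝ} (hxy : x ≤ y) :
    symmKernel p q x y = p x * q y - q x * p y := by
  simp [symmKernel, hxy]

lemma symmKernel_of_ge (p q : ℝ → ℝ) {x y : ℝ} (hyx : y ≤ x) :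
    symmKernel p q x y = p y * q x - q y * p x := by
  simp [symmKernel, hyx]

lemma continuous_symmKernel {p q : ℝ → ℝ} (hp : Continuous p) (hq : Continuous q) :
    Continuous (Function.uncurry (symmKernel p q)) := by
  unfold symmKernel Function.uncurry
  fun_prop

/-- The quadratic form of a symmetrized kernel is twice its integral over the lower triangle. -/
lemma integral_integral_symmKernel {p q g : ℝ → ℝ} (hp : Continuous p) (hq : Continuous q)
    (hg : Continuous g) {ℓ : ℝ} (hℓ : 0 ≤ ℓ) :
    ∫ x in (0:ℝ)..ℓ, g x * ∫ y in (0:ℝ)..ℓ, symmKernel p q x y * g y =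
      2 * ∫ x in (0:ℝ)..ℓ, g x * ∫ y in (0:ℝ)..x, (q x * p y - p x * q y) * g y := by
  have split (a b s t : ℝ) :
      ∫ y in s..t, (a * p y - b * q y) * g y =
        a * (∫ y in s..t, p y * g y) - b * ∫ y in s..t, q y * g y := by
    rw [← integral_const_mul, ← integral_const_mul, ← integral_sub]
    · congr 1; ext y; ring
    all_goals exact Continuous.intervalIntegrable (by fun_prop) _ _
  have contA : Continuous fun x => ∫ y in (0:ℝ)..x, p y * g y :=
    continuous_primitive (fun a b => (hp.mul hg).intervalIntegrable a b) 0
  have contB : Continuous fun x => ∫ y in (0:ℝ)..x, q y * g y :=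
    continuous_primitive (fun a b => (hq.mul hg).intervalIntegrable a b) 0
  have inner : ∀ x ∈ uIcc 0 ℓ, g x * ∫ y in (0:ℝ)..ℓ, symmKernel p q x y * g y =
      2 * (g x * ∫ y in (0:ℝ)..x, (q x * p y - p x * q y) * g y) +
        ((∫ y in (0:ℝ)..ℓ, q y * g y) * (p x * g x) -
          (∫ y in (0:ℝ)..ℓ, p y * g y) * (q x * g x)) := by
    intro x hx
    rw [uIcc_of_le hℓ] at hx
    have hK : Continuous fun y => symmKernel p q x y * g y :=
      ((continuous_symmKernel hp hq).comp (Continuous.prodMk_right x)).mul hg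
    have low : ∫ y in (0:ℝ)..x, symmKernel p q x y * g y =
        ∫ y in (0:ℝ)..x, (q x * p y - p x * q y) * g y := by
      refine integral_congr fun y hy => ?_
      rw [uIcc_of_le hx.1] at hy
      simp only [symmKernel_of_ge p q hy.2]
      ring
    have high : ∫ y in x..ℓ, symmKernel p q x y * g y =
        ∫ y in x..ℓ, ((-q x) * p y - (-p x) * q y) * g y := by
      refine integral_congr fun y hy => ?_
      rw [uIcc_of_le hx.2] at hy
      simp only [symmKernel_of_le p q hy.1]
      ring
    rw [← integral_add_adjacent_intervals (hK.intervalIntegrable 0 x)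
      (hK.intervalIntegrable x ℓ), low, high, split, split,
      ← integral_add_adjacent_intervals (f := fun y => p y * g y)
        ((hp.mul hg).intervalIntegrable 0 x) ((hp.mul hg).intervalIntegrable x ℓ),
      ← integral_add_adjacent_intervals (f := fun y => q y * g y)
        ((hq.mul hg).intervalIntegrable 0 x) ((hq.mul hg).intervalIntegrable x ℓ)]
    ring
  rw [integral_congr inner, integral_add, integral_sub]
  · simp only [integral_const_mul]
    ring
  all_goals refine Continuous.intervalIntegrable ?_ _ _
  all_goals try simp only [split]
  all_goals fun_prop

lemma integral_mul_integral_comm_of_symm {K : ℝ → ℝ → ℝ} (hK : Continuous (Function.uncurry K))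
    (hsymm : ∀ x y, K x y = K y x) {f g : ℝ → ℝ} (hf : Continuous f) (hg : Continuous g)
    (ℓ : ℝ) :
    ∫ x in (0:ℝ)..ℓ, f x * ∫ y in (0:ℝ)..ℓ, K x y * g y =
      ∫ x in (0:ℝ)..ℓ, g x * ∫ y in (0:ℝ)..ℓ, K x y * f y := by
  simp only [← integral_const_mul]
  rw [MeasureTheory.intervalIntegral_intervalIntegral_swap]
  · refine integral_congr fun y _ => integral_congr fun x _ => ?_
    simp only [hsymm x y]
    ring
  · have : Continuous fun z : ℝ × ℝ => f z.1 * (K z.1 z.2 * g z.2) := by fun_prop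
    exact (this.continuousOn.integrableOn_compact (isCompact_uIcc.prod isCompact_uIcc)).mono_set
      (Set.prod_mono uIoc_subset_uIcc uIoc_subset_uIcc)

lemma integral_linear_combination {f₁ f₂ f₃ f₄ : ℝ → ℝ} (h₁ : Continuous f₁)
    (h₂ : Continuous f₂) (h₃ : Continuous f₃) (h₄ : Continuous f₄) (c₁ c₂ c₃ c₄ a b : ℝ) :
    ∫ x in a..b, (c₁ * f₁ x - c₂ * f₂ x - c₃ * f₃ x + c₄ * f₄ x) =
      c₁ * (∫ x in a..b, f₁ x) - c₂ * (∫ x in a..b, f₂ x) - c₃ * (∫ x in a..b, f₃ x) +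
        c₄ * ∫ x in a..b, f₄ x := by
  rw [integral_add, integral_sub, integral_sub]
  · simp only [integral_const_mul]
  all_goals exact Continuous.intervalIntegrable (by fun_prop) _ _

/-- Integrating out `u` and `v` in the antisymmetrized kernel projects off `E`: the resulting
quadratic form at `h` is the quadratic form of `K` at `E * (h - L)`. -/
lemma integral_integral_antisymmetrized {K : ℝ → ℝ → ℝ} (hK : Continuous (Function.uncurry K))
    (hsymm : ∀ x y, K x y = K y x) {E h : ℝ → ℝ} (hE : Continuous E) (hh : Continuous h)
    {ℓ L : ℝ} (hEnorm : ∫ u in (0:ℝ)..ℓ, (E u) ^ 2 = 1)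
    (hL : L = ∫ u in (0:ℝ)..ℓ, (E u) ^ 2 * h u) :
    ∫ x in (0:ℝ)..ℓ, ∫ y in (0:ℝ)..ℓ,
      (∫ u in (0:ℝ)..ℓ, ∫ v in (0:ℝ)..ℓ,
        (K x y * E u * E v - K x v * E u * E y - K u y * E x * E v + K u v * E x * E y) *
          E u * E v) * (E x * E y) * h x * h y =
      ∫ x in (0:ℝ)..ℓ, (E x * (h x - L)) *
        ∫ y in (0:ℝ)..ℓ, K x y * (E y * (h y - L)) := by
  set P : ℝ → ℝ := fun x => ∫ v in (0:ℝ)..ℓ, K x v * E v with hP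
  set R : ℝ → ℝ := fun x => ∫ v in (0:ℝ)..ℓ, K x v * (E v * h v) with hR
  have cP : Continuous P := by rw [hP]; fun_prop
  have cR : Continuous R := by rw [hR]; fun_prop
  have cK (x : ℝ) : Continuous (K x) := hK.comp (Continuous.prodMk_right x)
  have P_symm (y : ℝ) : ∫ u in (0:ℝ)..ℓ, K u y * E u = P y := by
    simp only [hP, hsymm _ y]
  have comm : ∫ x in (0:ℝ)..ℓ, E x * R x = ∫ x in (0:ℝ)..ℓ, E x * h x * P x :=
    integral_mul_integral_comm_of_symm hK hsymm hE (hE.mul hh) ℓ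
  set c := ∫ u in (0:ℝ)..ℓ, E u * P u with hc
  have int_v (x y u : ℝ) : ∫ v in (0:ℝ)..ℓ,
      (K x y * E u * E v - K x v * E u * E y - K u y * E x * E v + K u v * E x * E y) *
        E u * E v =
      K x y * E u ^ 2 - E y * E u ^ 2 * P x - E x * (K u y * E u) + E x * E y * (E u * P u) := by
    trans K x y * E u ^ 2 * (∫ v in (0:ℝ)..ℓ, E v ^ 2) - E y * E u ^ 2 * P x -
      E x * (K u y * E u) * (∫ v in (0:ℝ)..ℓ, E v ^ 2) + E x * E y * E u * P u
    · simp only [hP]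
      rw [← integral_linear_combination (by fun_prop) (f₂ := fun v => K x v * E v)
        (by fun_prop) (by fun_prop) (f₄ := fun v => K u v * E v) (by fun_prop)]
      congr 1; ext v; ring
    · rw [hEnorm]; ring
  have int_u (x y : ℝ) : ∫ u in (0:ℝ)..ℓ,
      (K x y * E u ^ 2 - E y * E u ^ 2 * P x - E x * (K u y * E u) + E x * E y * (E u * P u)) =
      K x y - E y * P x - E x * P y + E x * E y * c := by
    trans K x y * (∫ u in (0:ℝ)..ℓ, E u ^ 2) - E y * P x * (∫ u in (0:ℝ)..ℓ, E u ^ 2) -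
      E x * (∫ u in (0:ℝ)..ℓ, K u y * E u) + E x * E y * c
    · rw [hc, ← integral_linear_combination (by fun_prop) (by fun_prop)
        (by simp only [hsymm _ y]; exact (cK y).mul hE) (by fun_prop)]
      congr 1; ext u; ring
    · rw [hEnorm, P_symm]; ring
  set S := ∫ x in (0:ℝ)..ℓ, E x * h x * P x with hS
  have int_y (x : ℝ) : ∫ y in (0:ℝ)..ℓ,
      (K x y - E y * P x - E x * P y + E x * E y * c) * (E x * E y) * h x * h y =
      E x * h x * R x - L * (E x * h x * P x) - S * (E x ^ 2 * h x) +
        L * c * (E x ^ 2 * h x) := by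
    trans E x * h x * R x - E x * h x * P x * (∫ u in (0:ℝ)..ℓ, (E u) ^ 2 * h u) -
      E x ^ 2 * h x * S + E x ^ 2 * h x * c * (∫ u in (0:ℝ)..ℓ, (E u) ^ 2 * h u)
    · simp only [hR, hS]
      rw [← integral_linear_combination (f₁ := fun y => K x y * (E y * h y)) (by fun_prop)
        (by fun_prop) (by fun_prop) (by fun_prop)]
      congr 1; ext y; ring
    · rw [← hL]; ring
  have rhs (x : ℝ) : E x * (h x - L) * ∫ y in (0:ℝ)..ℓ, K x y * (E y * (h y - L)) =
      1 * (E x * h x * R x) - L * (E x * h x * P x) - L * (E x * R x) + L ^ 2 * (E x * P x) := by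
    have : ∫ y in (0:ℝ)..ℓ, K x y * (E y * (h y - L)) = R x - L * P x := by
      rw [hR, hP, ← integral_const_mul, ← integral_sub]
      · congr 1; ext y; ring
      all_goals exact Continuous.intervalIntegrable (by fun_prop) _ _
    rw [this]; ring
  simp only [int_v, int_u, int_y, rhs]
  rw [integral_linear_combination (by fun_prop) (by fun_prop) (by fun_prop) (by fun_prop),
    comm, ← hS, ← hc]
  have := integral_linear_combination (f₁ := fun x => E x * h x * R x)
    (f₂ := fun x => E x * h x * P x) (f₃ := fun x => E x ^ 2 * h x)
    (f₄ := fun x => E x ^ 2 * h x) (by fun_prop) (by fun_prop) (by fun_prop) (by fun_prop)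
    1 L S (L * c) 0 ℓ
  simp only [one_mul] at this
  rw [this, ← hL, ← hS]
  ring

/-- Equality of the two expressions (D21) and (D22) for the second-order Fréchet
derivative of the eigenvalue in the potential (Theorem A). -/
theorem second_derivative_two_expressions (ℓ : ℝ) (hℓ : 0 < ℓ) (Q E h ψ₁ ψ₂ : ℝ → ℝ)
    (hQ : ContinuousOn Q (Set.Icc 0 ℓ)) (hE : ContinuousOn E (Set.Icc 0 ℓ))
    (hh : ContinuousOn h (Set.Icc 0 ℓ))
    (hEnorm : (∫ u in (0:ℝ)..ℓ, (E u) ^ 2) = 1)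
    (L : ℝ) (hL : L = ∫ u in (0:ℝ)..ℓ, (E u) ^ 2 * h u)
    (hψ₁ : ContDiffOn ℝ 2 ψ₁ (Set.Icc 0 ℓ)) (hψ₂ : ContDiffOn ℝ 2 ψ₂ (Set.Icc 0 ℓ))
    (hψ₁ode : ∀ x ∈ Set.Icc (0:ℝ) ℓ, -(deriv (deriv ψ₁) x) + Q x * ψ₁ x = 0)
    (hψ₂ode : ∀ x ∈ Set.Icc (0:ℝ) ℓ, -(deriv (deriv ψ₂) x) + Q x * ψ₂ x = 0)
    (hψ₁0 : ψ₁ 0 = 1) (hψ₁0' : deriv ψ₁ 0 = 0)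
    (hψ₂0 : ψ₂ 0 = 0) (hψ₂0' : deriv ψ₂ 0 = 1)
    (W : ℝ → ℝ → ℝ) (hW : ∀ x y, W x y = ψ₁ x * ψ₂ y - ψ₂ x * ψ₁ y)
    (U : ℝ → ℝ) (hU : ∀ x, U x = ∫ y in (0:ℝ)..x, W x y * E y * (L - h y))
    (G : ℝ → ℝ → ℝ)
    (hG₁ : ∀ x y : ℝ, x ≤ y → G x y = W x y)
    (hG₂ : ∀ x y : ℝ, y ≤ x → G x y = -W x y)
    (J₄ : ℝ → ℝ → ℝ → ℝ → ℝ)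
    (hJ₄ : ∀ x y u v, J₄ x y u v =
      G x y * E u * E v - G x v * E u * E y - G u y * E x * E v + G u v * E x * E y)
    (J : ℝ → ℝ → ℝ)
    (hJ : ∀ x y, J x y =
      (∫ u in (0:ℝ)..ℓ, ∫ v in (0:ℝ)..ℓ, J₄ x y u v * E u * E v) * (E x * E y)) :
    2 * ∫ x in (0:ℝ)..ℓ, E x * (h x - L) * U x =
      ∫ x in (0:ℝ)..ℓ, ∫ y in (0:ℝ)..ℓ, J x y * h x * h y := by
  have extend : ∀ f : ℝ → ℝ, ContinuousOn f (Icc 0 ℓ) →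
      ∃ g : ℝ → ℝ, Continuous g ∧ ∀ x ∈ Icc 0 ℓ, f x = g x := fun f hf =>
    ⟨IccExtend hℓ.le ((Icc 0 ℓ).domRestrict f), hf.domRestrict.Icc_extend',
      fun x hx => by rw [IccExtend_of_mem _ _ hx, domRestrict_apply]⟩
  obtain ⟨e, ce, he⟩ := extend E hE
  obtain ⟨k, ck, hk⟩ := extend h hh
  obtain ⟨p, cp, hp⟩ := extend ψ₁ hψ₁.continuousOn
  obtain ⟨q, cq, hq⟩ := extend ψ₂ hψ₂.continuousOn
  have hG : ∀ x ∈ Icc 0 ℓ, ∀ y ∈ Icc 0 ℓ, G x y = symmKernel p q x y := by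
    intro x hx y hy
    rcases le_total x y with hxy | hxy
    · rw [hG₁ x y hxy, hW, symmKernel_of_le p q hxy, hp x hx, hp y hy, hq x hx, hq y hy]
    · rw [hG₂ x y hxy, hW, symmKernel_of_ge p q hxy, hp x hx, hp y hy, hq x hx, hq y hy]
      ring
  have congr_Icc {f g : ℝ → ℝ} (hfg : ∀ x ∈ Icc 0 ℓ, f x = g x) :
      ∫ x in (0:ℝ)..ℓ, f x = ∫ x in (0:ℝ)..ℓ, g x :=
    integral_congr fun x hx => hfg x (by rwa [uIcc_of_le hℓ.le] at hx)
  have enorm : ∫ u in (0:ℝ)..ℓ, e u ^ 2 = 1 := by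
    rw [← hEnorm]
    exact congr_Icc fun u hu => by rw [he u hu]
  have hLe : L = ∫ u in (0:ℝ)..ℓ, e u ^ 2 * k u := by
    rw [hL]
    exact congr_Icc fun u hu => by rw [he u hu, hk u hu]
  trans ∫ x in (0:ℝ)..ℓ, (e x * (k x - L)) *
        ∫ y in (0:ℝ)..ℓ, symmKernel p q x y * (e y * (k y - L))
  · rw [integral_integral_symmKernel cp cq (g := fun x => e x * (k x - L)) (by fun_prop) hℓ.le]
    congr 1
    refine congr_Icc fun x hx => ?_
    rw [hU, he x hx, hk x hx]
    congr 1
    refine integral_congr fun y hy => ?_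
    rw [uIcc_of_le hx.1] at hy
    have hy' : y ∈ Icc 0 ℓ := ⟨hy.1, hy.2.trans hx.2⟩
    simp only [hW, he y hy', hk y hy', hp x hx, hp y hy', hq x hx, hq y hy']
    ring
  · rw [← integral_integral_antisymmetrized (continuous_symmKernel cp cq)
      (symmKernel_comm p q) ce ck enorm hLe]
    refine congr_Icc fun x hx => congr_Icc fun y hy => ?_
    rw [hJ, he x hx, he y hy, hk x hx, hk y hy]
    congr 3
    refine congr_Icc fun u hu => congr_Icc fun v hv => ?_
    rw [hJ₄, hG x hx y hy, hG x hx v hv, hG u hu y hy, hG u hu v hv, he x hx, he y hy,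
      he u hu, he v hv]
end
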